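/- Fix a weight w=(w₁,w₂) with w₁ ≥ w₂ > 0 and w₁+w₂ = 1. Let x ∈ ℝ²∖ℚ² and let Σ_x = (u_i)_{i∈ℕ} be a w-best approximation sequence of x. Then x is w-singular if and only if r(u_i)·|u_i| → 0 as i → ∞. -/

import Mathlib

open Filter

/-- The `w`-weighted quasi-norm `‖(y₁,y₂)‖_w = max(|y₁|^{1/w₁}, |y₂|^{1/w₂})`. -/
noncomputable def wnorm (w₁ w₂ : ℝ) (y : ℝ × ℝ) : ℝ :=
  max (|y.1| ^ (1 / w₁)) (|y.2| ^ (1 / w₂))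

/-- `A(x, v) = ‖q·x − p‖_w` for `v = (p₁, p₂, q)`. -/
noncomputable def Afun (w₁ w₂ : ℝ) (x : ℝ × ℝ) (v : ℤ × ℤ × ℤ) : ℝ :=
  wnorm w₁ w₂ ((v.2.2 : ℝ) * x.1 - (v.1 : ℝ), (v.2.2 : ℝ) * x.2 - (v.2.1 : ℝ))

/-- `Q` is the set of triples `(p₁, p₂, q) ∈ ℤ² × ℕ` with `gcd(p₁, p₂, q) = 1`. -/
def Qset : Set (ℤ × ℤ × ℤ) :=
  {v | 0 < v.2.2 ∧ Int.gcd (Int.gcd v.1 v.2.1) v.2.2 = 1}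

/-- `û = p/q ∈ ℚ² ⊆ ℝ²` for `u = (p, q)`. -/
noncomputable def uhat (u : ℤ × ℤ × ℤ) : ℝ × ℝ :=
  ((u.1 : ℝ) / (u.2.2 : ℝ), (u.2.1 : ℝ) / (u.2.2 : ℝ))

/-- `(p, q) ∈ ℤ² × ℕ` is a `w`-best approximate of `x`: its weighted error beats
every vector of strictly smaller denominator, and is minimal among vectors with the
same denominator. -/
def IsBest (w₁ w₂ : ℝ) (x : ℝ × ℝ) (u : ℤ × ℤ × ℤ) : Prop :=
  0 < u.2.2 ∧
  (∀ v : ℤ × ℤ × ℤ, 0 < v.2.2 → v.2.2 < u.2.2 →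
    Afun w₁ w₂ x u < Afun w₁ w₂ x v) ∧
  (∀ p : ℤ × ℤ, Afun w₁ w₂ x u ≤ Afun w₁ w₂ x (p.1, p.2, u.2.2))

/-- `r(u)`: the minimal value of `A(û, v)` over `v ∈ Q` with `v ≠ u`. -/
noncomputable def rfun (w₁ w₂ : ℝ) (u : ℤ × ℤ × ℤ) : ℝ :=
  sInf {a : ℝ | ∃ v ∈ Qset, v ≠ u ∧ a = Afun w₁ w₂ (uhat u) v}

/-- A `w`-best approximation sequence of `x`: a sequence of `w`-best approximates
of `x` in `Q` with `|u₀| > 1`, strictly increasing denominators, and no `w`-best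
approximate of `x` with denominator strictly between two consecutive terms. -/
def IsBestSeq (w₁ w₂ : ℝ) (x : ℝ × ℝ) (u : ℕ → ℤ × ℤ × ℤ) : Prop :=
  (∀ i, u i ∈ Qset) ∧ (∀ i, IsBest w₁ w₂ x (u i)) ∧ 1 < (u 0).2.2 ∧
  (∀ i, (u i).2.2 < (u (i + 1)).2.2) ∧
  (∀ i, ∀ v : ℤ × ℤ × ℤ, IsBest w₁ w₂ x v →
    ¬((u i).2.2 < v.2.2 ∧ v.2.2 < (u (i + 1)).2.2))

/-- `x ∈ ℝ²` is rational, i.e. `x ∈ ℚ²`. -/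
def IsRat (x : ℝ × ℝ) : Prop := ∃ a b : ℚ, x = ((a : ℝ), (b : ℝ))

/-- `x ∈ ℝ²` is `(w₁,w₂)`-singular. -/
def IsSingular (w₁ w₂ : ℝ) (x : ℝ × ℝ) : Prop :=
  ∀ ε : ℝ, 0 < ε → ∃ T₀ : ℝ, 1 < T₀ ∧ ∀ T : ℝ, T₀ < T →
    ∃ p₁ p₂ q : ℤ,
      |(q : ℝ) * x.1 - (p₁ : ℝ)| < ε ^ w₁ * T ^ (-w₁) ∧
      |(q : ℝ) * x.2 - (p₂ : ℝ)| < ε ^ w₂ * T ^ (-w₂) ∧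
      0 < q ∧ (q : ℝ) < T

section WeightedNorm

variable {w₁ w₂ : ℝ}

theorem wnorm_nonneg (y : ℝ × ℝ) : 0 ≤ wnorm w₁ w₂ y :=
  le_max_of_le_left (Real.rpow_nonneg (abs_nonneg _) _)

theorem wnorm_lt_iff (h₁ : 0 < w₁) (h₂ : 0 < w₂) {y : ℝ × ℝ} {a : ℝ} (ha : 0 ≤ a) :
    wnorm w₁ w₂ y < a ↔ |y.1| < a ^ w₁ ∧ |y.2| < a ^ w₂ := by
  rw [wnorm, max_lt_iff, one_div, one_div, Real.rpow_inv_lt_iff_of_pos (abs_nonneg _) ha h₁,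
    Real.rpow_inv_lt_iff_of_pos (abs_nonneg _) ha h₂]

theorem wnorm_le_iff (h₁ : 0 < w₁) (h₂ : 0 < w₂) {y : ℝ × ℝ} {a : ℝ} (ha : 0 ≤ a) :
    wnorm w₁ w₂ y ≤ a ↔ |y.1| ≤ a ^ w₁ ∧ |y.2| ≤ a ^ w₂ := by
  rw [wnorm, max_le_iff, one_div, one_div, Real.rpow_inv_le_iff_of_pos (abs_nonneg _) ha h₁,
    Real.rpow_inv_le_iff_of_pos (abs_nonneg _) ha h₂]

theorem Afun_nonneg (x : ℝ × ℝ) (v : ℤ × ℤ × ℤ) : 0 ≤ Afun w₁ w₂ x v :=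
  wnorm_nonneg _

theorem abs_le_Afun_rpow (h₁ : 0 < w₁) (h₂ : 0 < w₂) (x : ℝ × ℝ) (v : ℤ × ℤ × ℤ) :
    |(v.2.2 : ℝ) * x.1 - v.1| ≤ Afun w₁ w₂ x v ^ w₁ ∧
      |(v.2.2 : ℝ) * x.2 - v.2.1| ≤ Afun w₁ w₂ x v ^ w₂ :=
  (wnorm_le_iff h₁ h₂ (Afun_nonneg x v)).1 le_rfl

theorem Afun_congr_abs {x x' : ℝ × ℝ} {v v' : ℤ × ℤ × ℤ}
    (hfst : |(v.2.2 : ℝ) * x.1 - v.1| = |(v'.2.2 : ℝ) * x'.1 - v'.1|)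
    (hsnd : |(v.2.2 : ℝ) * x.2 - v.2.1| = |(v'.2.2 : ℝ) * x'.2 - v'.2.1|) :
    Afun w₁ w₂ x v = Afun w₁ w₂ x' v' := by
  simp only [Afun, wnorm, hfst, hsnd]

/-- For a fixed denominator, rounding both coordinates minimizes the weighted error. -/
theorem Afun_round_le (h₁ : 0 < w₁) (h₂ : 0 < w₂) (x : ℝ × ℝ) (p₁ p₂ q : ℤ) :
    Afun w₁ w₂ x (round ((q : ℝ) * x.1), round ((q : ℝ) * x.2), q) ≤
      Afun w₁ w₂ x (p₁, p₂, q) := by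
  have h := abs_le_Afun_rpow h₁ h₂ x (p₁, p₂, q)
  exact (wnorm_le_iff h₁ h₂ (Afun_nonneg _ _)).2
    ⟨(round_le _ _).trans h.1, (round_le _ _).trans h.2⟩

theorem two_le_two_rpow_inv_rpow {w : ℝ} (h₂ : 0 < w₂) (hw : w₂ ≤ w) :
    2 ≤ ((2 : ℝ) ^ w₂⁻¹) ^ w := by
  rw [← Real.rpow_mul (by norm_num)]
  have h : 1 ≤ w₂⁻¹ * w := by
    rw [inv_mul_eq_div, le_div_iff₀ h₂]
    linarith
  simpa using Real.rpow_le_rpow_of_exponent_le (by norm_num : (1 : ℝ) ≤ 2) h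

theorem two_mul_rpow_le {w s : ℝ} (h₂ : 0 < w₂) (hw : w₂ ≤ w) (hs : 0 ≤ s) :
    2 * s ^ w ≤ ((2 : ℝ) ^ w₂⁻¹ * s) ^ w := by
  rw [Real.mul_rpow (by positivity) hs]
  exact mul_le_mul_of_nonneg_right (two_le_two_rpow_inv_rpow h₂ hw) (Real.rpow_nonneg hs _)

end WeightedNorm

/-- A vector whose denominator is below that of the next best approximate does not
improve on the current best approximate. -/
theorem IsBestSeq.Afun_le {w₁ w₂ : ℝ} (h₁ : 0 < w₁) (h₂ : 0 < w₂) {x : ℝ × ℝ}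
    {u : ℕ → ℤ × ℤ × ℤ} (hu : IsBestSeq w₁ w₂ x u) (i : ℕ) (v : ℤ × ℤ × ℤ)
    (hv : 0 < v.2.2) (hvu : v.2.2 < (u (i + 1)).2.2) :
    Afun w₁ w₂ x (u i) ≤ Afun w₁ w₂ x v := by
  obtain ⟨-, hbest, -, -, hgap⟩ := hu
  by_contra! hlt
  classical
  have hex : ∃ n : ℕ, 0 < n ∧ ∃ p₁ p₂ : ℤ,
      Afun w₁ w₂ x (p₁, p₂, (n : ℤ)) < Afun w₁ w₂ x (u i) := by
    refine ⟨v.2.2.toNat, by omega, v.1, v.2.1, ?_⟩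
    rwa [Int.toNat_of_nonneg hv.le]
  obtain ⟨hn, p₁, p₂, hp⟩ := Nat.find_spec hex
  have hmin := fun m => Nat.find_min (H := hex) (m := m)
  have hnle : Nat.find hex ≤ v.2.2.toNat := by
    apply Nat.find_le
    refine ⟨by omega, v.1, v.2.1, ?_⟩
    rwa [Int.toNat_of_nonneg hv.le]
  generalize Nat.find hex = n at *
  refine hgap i (round ((n : ℝ) * x.1), round ((n : ℝ) * x.2), (n : ℤ)) ?_ ⟨?_, ?_⟩
  · have hround : ∀ a b : ℤ, Afun w₁ w₂ x (round ((n : ℝ) * x.1), round ((n : ℝ) * x.2), (n : ℤ)) ≤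
        Afun w₁ w₂ x (a, b, (n : ℤ)) := by
      intro a b
      simpa using Afun_round_le h₁ h₂ x a b (n : ℤ)
    refine ⟨by simpa using hn, fun v' hv' hlt' => ?_, fun p => hround _ _⟩
    refine (hround p₁ p₂).trans_lt (hp.trans_le ?_)
    by_contra! hlt''
    simp only at hlt'
    refine hmin v'.2.2.toNat (by omega) ⟨by omega, v'.1, v'.2.1, ?_⟩
    rwa [Int.toNat_of_nonneg hv'.le]
  · simp only
    by_contra! hle
    rcases hle.lt_or_eq with h | h
    · exact absurd hp ((hbest i).2.1 (p₁, p₂, (n : ℤ)) (by simpa using hn) h).le.not_gt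
    · rw [h] at hp
      exact absurd hp ((hbest i).2.2 (p₁, p₂)).not_gt
  · simp only
    omega

theorem IsBestSeq.Afun_succ_le {w₁ w₂ : ℝ} {x : ℝ × ℝ} {u : ℕ → ℤ × ℤ × ℤ}
    (hu : IsBestSeq w₁ w₂ x u) (i : ℕ) :
    Afun w₁ w₂ x (u (i + 1)) ≤ Afun w₁ w₂ x (u i) :=
  ((hu.2.1 (i + 1)).2.1 _ (hu.2.1 i).1 (hu.2.2.2.1 i)).le

theorem IsBestSeq.lt_denominator {w₁ w₂ : ℝ} {x : ℝ × ℝ} {u : ℕ → ℤ × ℤ × ℤ}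
    (hu : IsBestSeq w₁ w₂ x u) (i : ℕ) : (i : ℤ) + 1 < (u i).2.2 := by
  induction i with
  | zero => simpa using hu.2.2.1
  | succ n ih =>
    have := hu.2.2.2.1 n
    push_cast
    omega

theorem isSingular_iff_Afun {w₁ w₂ : ℝ} (h₁ : 0 < w₁) (h₂ : 0 < w₂) (x : ℝ × ℝ) :
    IsSingular w₁ w₂ x ↔ ∀ ε : ℝ, 0 < ε → ∃ T₀ : ℝ, 1 < T₀ ∧ ∀ T : ℝ, T₀ < T →
      ∃ v : ℤ × ℤ × ℤ, Afun w₁ w₂ x v < ε / T ∧ 0 < v.2.2 ∧ (v.2.2 : ℝ) < T := by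
  have key : ∀ ε T : ℝ, 0 < ε → 0 < T → ∀ w : ℝ, ε ^ w * T ^ (-w) = (ε / T) ^ w := by
    intro ε T hε hT w
    rw [Real.div_rpow hε.le hT.le, Real.rpow_neg hT.le, div_eq_mul_inv]
  unfold IsSingular
  refine forall₂_congr fun ε hε => exists_congr fun T₀ => and_congr_right fun hT₀ =>
    forall₂_congr fun T hT => ?_
  have hT' : 0 < T := by linarith
  rw [key ε T hε hT', key ε T hε hT']
  have hdiv : 0 ≤ ε / T := by positivity
  constructor
  · rintro ⟨p₁, p₂, q, ha, hb, hq⟩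
    exact ⟨(p₁, p₂, q), (wnorm_lt_iff h₁ h₂ hdiv).2 ⟨ha, hb⟩, hq⟩
  · rintro ⟨v, hv, hq⟩
    obtain ⟨ha, hb⟩ := (wnorm_lt_iff h₁ h₂ hdiv).1 hv
    exact ⟨v.1, v.2.1, v.2.2, ha, hb, hq⟩

theorem IsBestSeq.isSingular_iff {w₁ w₂ : ℝ} (h₁ : 0 < w₁) (h₂ : 0 < w₂) {x : ℝ × ℝ}
    {u : ℕ → ℤ × ℤ × ℤ} (hu : IsBestSeq w₁ w₂ x u) :
    IsSingular w₁ w₂ x ↔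
      Tendsto (fun i => Afun w₁ w₂ x (u i) * ((u (i + 1)).2.2 : ℝ)) atTop (nhds 0) := by
  have hq : ∀ i : ℕ, (i : ℝ) + 1 < ((u i).2.2 : ℝ) := fun i => by
    exact_mod_cast hu.lt_denominator i
  have hpos : ∀ i : ℕ, 0 < ((u i).2.2 : ℝ) := fun i => by
    exact_mod_cast (hu.2.1 i).1
  rw [isSingular_iff_Afun h₁ h₂, Metric.tendsto_atTop]
  constructor
  · intro h ε hε
    obtain ⟨T₀, -, hT⟩ := h ε hε
    obtain ⟨N, hN⟩ := exists_nat_gt T₀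
    refine ⟨N, fun n hn => ?_⟩
    have hn' : (N : ℝ) ≤ n := by exact_mod_cast hn
    have hn1 := hq (n + 1)
    push_cast at hn1
    obtain ⟨v, hv, hv0, hvT⟩ := hT ((u (n + 1)).2.2 : ℝ) (by linarith)
    have hle := hu.Afun_le h₁ h₂ n v hv0 (by exact_mod_cast hvT)
    rw [Real.dist_eq, sub_zero,
      abs_of_nonneg (mul_nonneg (Afun_nonneg _ _) (hpos _).le)]
    exact (lt_div_iff₀ (hpos _)).1 (hle.trans_lt hv)
  · intro h ε hε
    obtain ⟨N, hN⟩ := h ε hε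
    refine ⟨((u N).2.2 : ℝ), ?_, fun T hT => ?_⟩
    · have := hq N
      have : (0 : ℝ) ≤ N := Nat.cast_nonneg N
      linarith
    · classical
      have hex : ∃ k : ℕ, T ≤ ((u (N + k)).2.2 : ℝ) := by
        obtain ⟨k, hk⟩ := exists_nat_gt T
        refine ⟨k, ?_⟩
        have := hq (N + k)
        push_cast at this
        have : (0 : ℝ) ≤ N := Nat.cast_nonneg N
        linarith
      have hspec := Nat.find_spec hex
      have hmin := fun m => Nat.find_min (H := hex) (m := m)
      generalize Nat.find hex = k at *
      cases k with
      | zero =>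
        rw [add_zero] at hspec
        linarith
      | succ k =>
        have hlt := hmin k (Nat.lt_succ_self k)
        push Not at hlt
        refine ⟨u (N + k), ?_, (hu.2.1 _).1, hlt⟩
        have hT0 : 0 < T := (hpos _).trans hT
        have hA := hN (N + k) (Nat.le_add_right _ _)
        rw [Real.dist_eq, sub_zero,
          abs_of_nonneg (mul_nonneg (Afun_nonneg _ _) (hpos _).le)] at hA
        rw [lt_div_iff₀ hT0]
        exact (mul_le_mul_of_nonneg_left hspec (Afun_nonneg _ _)).trans_lt hA

/-- An integer multiple of a primitive vector that is itself primitive, with both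
denominators positive, is the vector itself. -/
theorem eq_of_mem_Qset_of_eq_mul {u v : ℤ × ℤ × ℤ} (hu : u ∈ Qset) (hv : v ∈ Qset) (k : ℤ)
    (h₁ : v.1 = k * u.1) (h₂ : v.2.1 = k * u.2.1) (h₃ : v.2.2 = k * u.2.2) : v = u := by
  obtain ⟨hv0, hvg⟩ := hv
  have hu0 := hu.1
  have hdvd : k ∣ ((Int.gcd (Int.gcd v.1 v.2.1) v.2.2 : ℕ) : ℤ) :=
    Int.dvd_coe_gcd (Int.dvd_coe_gcd ⟨_, h₁⟩ ⟨_, h₂⟩) ⟨_, h₃⟩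
  rw [hvg] at hdvd
  have hk : 0 < k := by
    rw [h₃] at hv0
    exact pos_of_mul_pos_left hv0 hu0.le
  have hk1 : k = 1 := Int.eq_one_of_dvd_one hk.le (by simpa using hdvd)
  subst hk1
  exact Prod.ext (by simpa using h₁) (Prod.ext (by simpa using h₂) (by simpa using h₃))

/-- Every `v ∈ Q` other than `u` can be moved, modulo `u` and up to sign, to a nonzero
vector with denominator in `[0, |u| / 2]`, without changing its error at `û`. -/
theorem exists_reduced {w₁ w₂ : ℝ} {u v : ℤ × ℤ × ℤ} (hu : u ∈ Qset) (hv : v ∈ Qset)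
    (hne : v ≠ u) :
    ∃ v' : ℤ × ℤ × ℤ, v' ≠ 0 ∧ 0 ≤ v'.2.2 ∧ 2 * v'.2.2 ≤ u.2.2 ∧
      Afun w₁ w₂ (uhat u) v' = Afun w₁ w₂ (uhat u) v := by
  have hu0 : 0 < u.2.2 := hu.1
  have hu0' : (u.2.2 : ℝ) ≠ 0 := by exact_mod_cast hu0.ne'
  have hz : ∀ k : ℤ, ¬(v.1 = k * u.1 ∧ v.2.1 = k * u.2.1 ∧ v.2.2 = k * u.2.2) :=
    fun k ⟨a, b, c⟩ => hne (eq_of_mem_Qset_of_eq_mul hu hv k a b c)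
  have hmod := Int.emod_add_mul_ediv v.2.2 u.2.2
  have hnn := Int.emod_nonneg v.2.2 hu0.ne'
  have hlt := Int.emod_lt_of_pos v.2.2 hu0
  generalize v.2.2 % u.2.2 = m at *
  generalize v.2.2 / u.2.2 = k at *
  have hm : v.2.2 = m + u.2.2 * k := hmod.symm
  by_cases hhalf : 2 * m ≤ u.2.2
  · refine ⟨(v.1 - k * u.1, v.2.1 - k * u.2.1, v.2.2 - k * u.2.2), ?_, ?_, ?_, ?_⟩
    · intro h0
      simp only [Prod.ext_iff, Prod.fst_zero, Prod.snd_zero, sub_eq_zero] at h0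
      exact hz k h0
    · simp only; linarith
    · simp only; linarith
    · apply Afun_congr_abs
      · simp only [uhat]; congr 1; push_cast; field_simp; ring
      · simp only [uhat]; congr 1; push_cast; field_simp; ring
  · refine ⟨((k + 1) * u.1 - v.1, (k + 1) * u.2.1 - v.2.1, (k + 1) * u.2.2 - v.2.2),
      ?_, ?_, ?_, ?_⟩
    · intro h0
      simp only [Prod.ext_iff, Prod.fst_zero, Prod.snd_zero, sub_eq_zero] at h0
      exact hz (k + 1) ⟨h0.1.symm, h0.2.1.symm, h0.2.2.symm⟩
    · simp only; linarith
    · simp only; linarith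
    · apply Afun_congr_abs
      · rw [← abs_neg]; simp only [uhat]; congr 1; push_cast; field_simp; ring
      · rw [← abs_neg]; simp only [uhat]; congr 1; push_cast; field_simp; ring

/-- A nonzero vector with zero denominator has error at least `1`. -/
theorem one_le_Afun {w₁ w₂ : ℝ} (h₁ : 0 < w₁) (h₂ : 0 < w₂) (x : ℝ × ℝ) {v : ℤ × ℤ × ℤ}
    (hv : v ≠ 0) (h0 : v.2.2 = 0) : 1 ≤ Afun w₁ w₂ x v := by
  by_contra! hlt
  obtain ⟨ha, hb⟩ := (wnorm_lt_iff h₁ h₂ zero_le_one).1 hlt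
  simp only [h0, Real.one_rpow, Int.cast_zero, zero_mul, zero_sub, abs_neg] at ha hb
  have ha' : |v.1| < 1 := by exact_mod_cast ha
  have hb' : |v.2.1| < 1 := by exact_mod_cast hb
  rw [Int.abs_lt_one_iff] at ha' hb'
  exact hv (Prod.ext ha' (Prod.ext hb' h0))

theorem rfun_nonneg (w₁ w₂ : ℝ) (u : ℤ × ℤ × ℤ) : 0 ≤ rfun w₁ w₂ u := by
  apply Real.sInf_nonneg
  rintro a ⟨v, -, -, rfl⟩
  exact Afun_nonneg _ _

theorem rfun_le_Afun {w₁ w₂ : ℝ} {u v : ℤ × ℤ × ℤ} (hv : v ∈ Qset) (hne : v ≠ u) :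
    rfun w₁ w₂ u ≤ Afun w₁ w₂ (uhat u) v := by
  refine csInf_le ⟨0, ?_⟩ ⟨v, hv, hne, rfl⟩
  rintro a ⟨v, -, -, rfl⟩
  exact Afun_nonneg _ _

/-- The error at `p / q` and the error at `y` differ by a multiple of `q y - p`. -/
theorem mul_div_sub_eq (a b p q y : ℝ) (hq : q ≠ 0) :
    a * (p / q) - b = (a * y - b) - a / q * (q * y - p) := by
  field_simp
  ring

theorem IsBestSeq.rfun_succ_le {w₁ w₂ : ℝ} (h₂ : 0 < w₂) (hw : w₂ ≤ w₁) {x : ℝ × ℝ}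
    {u : ℕ → ℤ × ℤ × ℤ} (hu : IsBestSeq w₁ w₂ x u) (i : ℕ) :
    rfun w₁ w₂ (u (i + 1)) ≤ 2 ^ w₂⁻¹ * Afun w₁ w₂ x (u i) := by
  have h₁ : 0 < w₁ := h₂.trans_le hw
  have hA := Afun_nonneg (w₁ := w₁) (w₂ := w₂) x (u i)
  have hlt := hu.2.2.2.1 i
  have hi : 0 < ((u i).2.2 : ℝ) := by exact_mod_cast (hu.2.1 i).1
  have hi1 : 0 < ((u (i + 1)).2.2 : ℝ) := by exact_mod_cast (hu.2.1 (i + 1)).1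
  have hlt' : ((u i).2.2 : ℝ) < ((u (i + 1)).2.2 : ℝ) := by exact_mod_cast hlt
  have hc : ((u i).2.2 : ℝ) / ((u (i + 1)).2.2 : ℝ) ≤ 1 := (div_le_one hi1).2 hlt'.le
  have hne : u i ≠ u (i + 1) := fun h => by rw [← h] at hlt; exact lt_irrefl _ hlt
  have coord : ∀ {w b p y : ℝ}, w₂ ≤ w → |((u i).2.2 : ℝ) * y - b| ≤ Afun w₁ w₂ x (u i) ^ w →
      |((u (i + 1)).2.2 : ℝ) * y - p| ≤ Afun w₁ w₂ x (u (i + 1)) ^ w →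
      |((u i).2.2 : ℝ) * (p / ((u (i + 1)).2.2 : ℝ)) - b| ≤
        (2 ^ w₂⁻¹ * Afun w₁ w₂ x (u i)) ^ w := by
    intro w b p y hw' hb hp
    have hmono : Afun w₁ w₂ x (u (i + 1)) ^ w ≤ Afun w₁ w₂ x (u i) ^ w :=
      Real.rpow_le_rpow (Afun_nonneg _ _) (hu.Afun_succ_le i) (h₂.le.trans hw')
    rw [mul_div_sub_eq _ b p _ y hi1.ne']
    have hsmall : |((u i).2.2 : ℝ) / ((u (i + 1)).2.2 : ℝ) * (((u (i + 1)).2.2 : ℝ) * y - p)| ≤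
        Afun w₁ w₂ x (u i) ^ w := by
      rw [abs_mul, abs_of_pos (div_pos hi hi1)]
      exact (mul_le_of_le_one_left (abs_nonneg _) hc).trans (hp.trans hmono)
    calc _ ≤ _ := abs_sub _ _
      _ ≤ 2 * Afun w₁ w₂ x (u i) ^ w := by linarith
      _ ≤ _ := two_mul_rpow_le h₂ hw' hA
  have hb := abs_le_Afun_rpow h₁ h₂ x (u i)
  have hp := abs_le_Afun_rpow h₁ h₂ x (u (i + 1))
  exact (rfun_le_Afun (hu.1 i) hne).trans ((wnorm_le_iff h₁ h₂ (by positivity)).2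
    ⟨coord hw hb.1 hp.1, coord le_rfl hb.2 hp.2⟩)

theorem IsBestSeq.Afun_le_of_Afun_uhat_lt_one {w₁ w₂ : ℝ} (h₂ : 0 < w₂) (hw : w₂ ≤ w₁)
    {x : ℝ × ℝ} {u : ℕ → ℤ × ℤ × ℤ} (hu : IsBestSeq w₁ w₂ x u) (i : ℕ) {v : ℤ × ℤ × ℤ}
    (hv : v ∈ Qset) (hne : v ≠ u (i + 1)) (hlt : Afun w₁ w₂ (uhat (u (i + 1))) v < 1) :
    Afun w₁ w₂ x (u i) ≤ 2 ^ w₂⁻¹ * Afun w₁ w₂ (uhat (u (i + 1))) v := by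
  have h₁ : 0 < w₁ := h₂.trans_le hw
  obtain ⟨v', hv0, hvnn, hhalf, heq⟩ :=
    exists_reduced (w₁ := w₁) (w₂ := w₂) (hu.1 (i + 1)) hv hne
  rw [← heq] at hlt ⊢
  have hpos : 0 < v'.2.2 := hvnn.lt_of_ne fun h =>
    absurd hlt (one_le_Afun h₁ h₂ _ hv0 h.symm).not_gt
  have hq : 0 < (u (i + 1)).2.2 := (hu.2.1 (i + 1)).1
  have hq' : 0 < ((u (i + 1)).2.2 : ℝ) := by exact_mod_cast hq
  have hpos' : 0 < (v'.2.2 : ℝ) := by exact_mod_cast hpos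
  have hhalf' : 2 * (v'.2.2 : ℝ) ≤ ((u (i + 1)).2.2 : ℝ) := by exact_mod_cast hhalf
  have hc : (v'.2.2 : ℝ) / ((u (i + 1)).2.2 : ℝ) ≤ 1 / 2 := by
    rw [div_le_iff₀ hq']
    linarith
  by_contra! hcon
  have hS := Afun_nonneg (w₁ := w₁) (w₂ := w₂) (uhat (u (i + 1))) v'
  have coord : ∀ {w b p y : ℝ}, w₂ ≤ w →
      |(v'.2.2 : ℝ) * (p / ((u (i + 1)).2.2 : ℝ)) - b| ≤
        Afun w₁ w₂ (uhat (u (i + 1))) v' ^ w →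
      |((u (i + 1)).2.2 : ℝ) * y - p| ≤ Afun w₁ w₂ x (u (i + 1)) ^ w →
      |(v'.2.2 : ℝ) * y - b| < Afun w₁ w₂ x (u i) ^ w := by
    intro w b p y hw' hb hp
    have hmono : Afun w₁ w₂ x (u (i + 1)) ^ w ≤ Afun w₁ w₂ x (u i) ^ w :=
      Real.rpow_le_rpow (Afun_nonneg _ _) (hu.Afun_succ_le i) (h₂.le.trans hw')
    have hstrict : (2 ^ w₂⁻¹ * Afun w₁ w₂ (uhat (u (i + 1))) v') ^ w < Afun w₁ w₂ x (u i) ^ w :=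
      Real.rpow_lt_rpow (by positivity) hcon (h₂.trans_le hw')
    have htwo := two_mul_rpow_le h₂ hw' hS
    have hsmall : |(v'.2.2 : ℝ) / ((u (i + 1)).2.2 : ℝ) * (((u (i + 1)).2.2 : ℝ) * y - p)| ≤
        1 / 2 * Afun w₁ w₂ x (u i) ^ w := by
      rw [abs_mul, abs_of_pos (div_pos hpos' hq')]
      exact mul_le_mul hc (hp.trans hmono) (abs_nonneg _) (by norm_num)
    have hsplit := mul_div_sub_eq (v'.2.2 : ℝ) b p _ y hq'.ne'
    rw [eq_sub_iff_add_eq] at hsplit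
    rw [← hsplit]
    exact (abs_add_le _ _).trans_lt (by linarith)
  have hb := abs_le_Afun_rpow h₁ h₂ (uhat (u (i + 1))) v'
  have hp := abs_le_Afun_rpow h₁ h₂ x (u (i + 1))
  have hbetter : Afun w₁ w₂ x v' < Afun w₁ w₂ x (u i) :=
    (wnorm_lt_iff h₁ h₂ (Afun_nonneg _ _)).2 ⟨coord hw hb.1 hp.1, coord le_rfl hb.2 hp.2⟩
  exact absurd hbetter (hu.Afun_le h₁ h₂ i v' hpos (by omega)).not_gt

theorem IsBestSeq.Afun_le_of_rfun_succ_lt_one {w₁ w₂ : ℝ} (h₂ : 0 < w₂) (hw : w₂ ≤ w₁)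
    {x : ℝ × ℝ} {u : ℕ → ℤ × ℤ × ℤ} (hu : IsBestSeq w₁ w₂ x u) (i : ℕ)
    (hlt : rfun w₁ w₂ (u (i + 1)) < 1) :
    Afun w₁ w₂ x (u i) ≤ 2 ^ w₂⁻¹ * rfun w₁ w₂ (u (i + 1)) := by
  have hC : (0 : ℝ) < 2 ^ w₂⁻¹ := by positivity
  have hden := hu.2.2.2.1 i
  have hne : u i ≠ u (i + 1) := fun h => by rw [← h] at hden; exact lt_irrefl _ hden
  rw [← div_le_iff₀' hC]
  by_contra! hcon
  have hnonempty : {a : ℝ | ∃ v ∈ Qset, v ≠ u (i + 1) ∧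
      a = Afun w₁ w₂ (uhat (u (i + 1))) v}.Nonempty := ⟨_, u i, hu.1 i, hne, rfl⟩
  obtain ⟨a, ⟨v, hv, hvne, rfl⟩, ha⟩ :=
    exists_lt_of_csInf_lt hnonempty (lt_min hcon hlt)
  rw [lt_min_iff] at ha
  have h := hu.Afun_le_of_Afun_uhat_lt_one h₂ hw i hv hvne ha.2
  rw [← div_le_iff₀' hC] at h
  exact absurd ha.1 h.not_gt

/-- For `x ∈ ℝ² ∖ ℚ²` with best approximation sequence `(uᵢ)`, `x` is `w`-singular
if and only if `r(uᵢ)·|uᵢ| → 0`. -/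
theorem singular_iff_rfun_tendsto_zero (w₁ w₂ : ℝ) (hw₂ : 0 < w₂) (hw : w₂ ≤ w₁)
    (hsum : w₁ + w₂ = 1) (x : ℝ × ℝ) (hx : ¬IsRat x)
    (u : ℕ → ℤ × ℤ × ℤ) (hu : IsBestSeq w₁ w₂ x u) :
    IsSingular w₁ w₂ x ↔
      Tendsto (fun i => rfun w₁ w₂ (u i) * ((u i).2.2 : ℝ)) atTop (nhds 0) := by
  have hone : ∀ i, (1 : ℝ) ≤ ((u i).2.2 : ℝ) := fun i => by
    exact_mod_cast (hu.2.1 i).1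
  rw [hu.isSingular_iff (hw₂.trans_le hw) hw₂,
    ← tendsto_add_atTop_iff_nat (f := fun i => rfun w₁ w₂ (u i) * ((u i).2.2 : ℝ)) 1]
  constructor
  · intro h
    refine squeeze_zero (fun i => mul_nonneg (rfun_nonneg _ _ _) (zero_le_one.trans (hone _)))
      (fun i => ?_) (by simpa using h.const_mul ((2 : ℝ) ^ w₂⁻¹))
    rw [← mul_assoc]
    exact mul_le_mul_of_nonneg_right (hu.rfun_succ_le hw₂ hw i) (zero_le_one.trans (hone _))
  · intro h
    refine squeeze_zero'
      (Eventually.of_forall fun i => mul_nonneg (Afun_nonneg _ _) (zero_le_one.trans (hone _)))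
      ?_ (by simpa using h.const_mul ((2 : ℝ) ^ w₂⁻¹))
    filter_upwards [h.eventually_lt_const zero_lt_one] with i hi
    rw [← mul_assoc]
    refine mul_le_mul_of_nonneg_right (hu.Afun_le_of_rfun_succ_lt_one hw₂ hw i ?_)
      (zero_le_one.trans (hone _))
    exact (le_mul_of_one_le_right (rfun_nonneg _ _ _) (hone _)).trans_lt hi
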